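/- Reflection invariance: for m ≥ 2 and S = {a_1 < ... < a_m}, and any index j with a_{j−1} < a_j < a_{j+1} (indices cyclic), A_{k+1}({a_1,...,a_{j−1}, a_j, a_{j+1},...,a_m}) = A_{k+1}({a_1,...,a_{j−1}, a_{j+1}+a_{j−1}−a_j, a_{j+1},...,a_m}); that is, A_{k+1}(S) is unchanged by reflecting a_j across the midpoint of a_{j−1} and a_{j+1}. -/

import Mathlib

/-- Two blocks `B`, `B'` form a crossing: there are `i, k ∈ B` and `j, l ∈ B'`
with `i < j < k < l` or `i > j > k > l`. -/
def Crosses (B B' : Finset ℕ) : Prop :=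
  ∃ i ∈ B, ∃ k ∈ B, ∃ j ∈ B', ∃ l ∈ B',
    (i < j ∧ j < k ∧ k < l) ∨ (i > j ∧ j > k ∧ k > l)

/-- `ρ` is a set partition of `{0, ..., n-1}`. -/
def IsPartitionOf (n : ℕ) (ρ : Finset (Finset ℕ)) : Prop :=
  (∀ B ∈ ρ, B.Nonempty) ∧
  (∀ B ∈ ρ, ∀ B' ∈ ρ, B ≠ B' → Disjoint B B') ∧
  ρ.sup id = Finset.range n

/-- `r` is an orientation of the crossing graph `G(ρ)`: it relates exactly the
pairs of distinct crossing blocks of `ρ`, choosing one direction for each edge. -/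
def IsOrientation (ρ : Finset (Finset ℕ)) (r : Finset ℕ → Finset ℕ → Prop) : Prop :=
  (∀ B B', r B B' → B ∈ ρ ∧ B' ∈ ρ ∧ B ≠ B' ∧ Crosses B B') ∧
  (∀ B ∈ ρ, ∀ B' ∈ ρ, B ≠ B' → Crosses B B' → (r B B' ↔ ¬ r B' B))

/-- An orientation is acyclic if it has no directed cycle. -/
def AcyclicRel (r : Finset ℕ → Finset ℕ → Prop) : Prop :=
  ∀ B, ¬ Relation.TransGen r B B

/-- `r` is a root-connected orientation of `G(ρ)` with root `S`: it is an acyclic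
orientation and `S` is its unique source. -/
def RootConnected (ρ : Finset (Finset ℕ)) (r : Finset ℕ → Finset ℕ → Prop)
    (S : Finset ℕ) : Prop :=
  IsOrientation ρ r ∧ AcyclicRel r ∧ S ∈ ρ ∧ (∀ B', ¬ r B' S) ∧
    (∀ B ∈ ρ, (∀ B', ¬ r B' B) → B = S)

/-- `ρ ∈ M_S(n)`: a partition of `{0,...,n-1}` with `S` as a block and all
other blocks of size 2. -/
def MSPartition (n : ℕ) (S : Finset ℕ) (ρ : Finset (Finset ℕ)) : Prop :=
  IsPartitionOf n ρ ∧ S ∈ ρ ∧ ∀ B ∈ ρ, B ≠ S → B.card = 2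

/-- The number of pairs `(ρ, r)` with `ρ ∈ M_S(n)` and `r` a root-connected
orientation of `G(ρ)` with root `S`.  (This is `A_{k+1}(S)` when `n = |S| + 2k`.) -/
noncomputable def countA (n : ℕ) (S : Finset ℕ) : ℕ :=
  Nat.card {p : Finset (Finset ℕ) × (Finset ℕ → Finset ℕ → Prop) //
    MSPartition n S p.1 ∧ RootConnected p.1 p.2 S}

theorem Crosses.symm {B B' : Finset ℕ} (h : Crosses B B') : Crosses B' B := by
  obtain ⟨i, hi, k, hk, j, hj, l, hl, h⟩ := h
  exact ⟨l, hl, j, hj, k, hk, i, hi, by omega⟩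

/-- `ρ` is a perfect matching of the points of `U`. -/
def IsMatchingOf (U : Finset ℕ) (ρ : Finset (Finset ℕ)) : Prop :=
  (∀ B ∈ ρ, B.card = 2) ∧ (∀ B ∈ ρ, ∀ B' ∈ ρ, B ≠ B' → Disjoint B B') ∧ ρ.sup id = U

/-- Perfect matchings of `U` together with an acyclic orientation of their crossing graph. -/
def orientedMatchings (U : Finset ℕ) :
    Set (Finset (Finset ℕ) × (Finset ℕ → Finset ℕ → Prop)) :=
  {p | IsMatchingOf U p.1 ∧ IsOrientation p.1 p.2 ∧ AcyclicRel p.2}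

/-- `I` is a noncrossing partial matching of the points outside `S`, none of whose chords
crosses `S`. -/
def IsNoncrossingWith (S : Finset ℕ) (I : Finset (Finset ℕ)) : Prop :=
  (∀ B ∈ I, B.card = 2) ∧ (∀ B ∈ I, Disjoint B S) ∧ (∀ B ∈ I, ¬ Crosses B S) ∧
    ∀ B ∈ I, ∀ B' ∈ I, B ≠ B' → Disjoint B B' ∧ ¬ Crosses B B'

/-- Partitions in `M_S(n)` with an acyclic orientation having `S` as one of its sources. -/
def orientedWithSource (n : ℕ) (S : Finset ℕ) :
    Set (Finset (Finset ℕ) × (Finset ℕ → Finset ℕ → Prop)) :=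
  {p | MSPartition n S p.1 ∧ IsOrientation p.1 p.2 ∧ AcyclicRel p.2 ∧ ∀ B', ¬ p.2 B' S}

open Classical in
/-- The sources of an orientation other than `S`. -/
noncomputable def otherSources (S : Finset ℕ)
    (p : Finset (Finset ℕ) × (Finset ℕ → Finset ℕ → Prop)) : Finset (Finset ℕ) :=
  {B ∈ p.1.erase S | ∀ B', ¬ p.2 B' B}

theorem finite_orientations (P : Finset (Finset ℕ)) :
    {p : Finset (Finset ℕ) × (Finset ℕ → Finset ℕ → Prop) |
      p.1 ⊆ P ∧ IsOrientation p.1 p.2}.Finite := by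
  classical
  refine (((P.powerset ×ˢ (P ×ˢ P).powerset).finite_toSet).image
    fun q => (q.1, fun B B' => (B, B') ∈ q.2)).subset ?_
  rintro ⟨ρ, r⟩ ⟨hρ, hr⟩
  refine ⟨(ρ, (P ×ˢ P).filter fun q => r q.1 q.2), ?_, ?_⟩
  · simp only [Finset.coe_product, Finset.coe_powerset, Set.mem_prod, Set.mem_preimage,
      Set.mem_powerset_iff, Finset.coe_subset]
    exact ⟨hρ, by exact_mod_cast Finset.filter_subset _ _⟩
  · ext B B'
    · rfl
    · simp only [Finset.mem_filter, Finset.mem_product, and_iff_right_iff_imp]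
      exact fun h => ⟨hρ (hr.1 _ _ h).1, hρ (hr.1 _ _ h).2.1⟩

theorem orientedWithSource_finite (n : ℕ) (S : Finset ℕ) : (orientedWithSource n S).Finite := by
  refine (finite_orientations (Finset.range n).powerset).subset ?_
  rintro p ⟨⟨⟨-, -, h⟩, -⟩, hr, -⟩
  refine ⟨fun B hB => ?_, hr⟩
  rw [Finset.mem_powerset, ← h]
  exact Finset.le_sup (f := id) hB

theorem rootConnected_iff {n : ℕ} {S : Finset ℕ}
    (p : Finset (Finset ℕ) × (Finset ℕ → Finset ℕ → Prop)) :
    MSPartition n S p.1 ∧ RootConnected p.1 p.2 S ↔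
      p ∈ orientedWithSource n S ∧ otherSources S p = ∅ := by
  simp only [RootConnected, orientedWithSource, otherSources, Set.mem_ofPred_eq,
    Finset.filter_eq_empty_iff, Finset.mem_erase]
  constructor
  · rintro ⟨h1, h2, h3, h4, h5, h6⟩
    exact ⟨⟨h1, h2, h3, h5⟩, fun B hB h => hB.1 (h6 B hB.2 h)⟩
  · rintro ⟨⟨h1, h2, h3, h5⟩, h6⟩
    exact ⟨h1, h2, h3, h1.2.1, h5, fun B hB h => by_contra fun hne => h6 ⟨hne, hB⟩ h⟩

theorem isNoncrossingWith_of_subset_otherSources {n : ℕ} {S : Finset ℕ}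
    {p : Finset (Finset ℕ) × (Finset ℕ → Finset ℕ → Prop)} (hp : p ∈ orientedWithSource n S)
    {I : Finset (Finset ℕ)} (hI : I ⊆ otherSources S p) :
    I ⊆ (Finset.range n \ S).powerset ∧ IsNoncrossingWith S I := by
  obtain ⟨⟨⟨hne, hdis, hsup⟩, hS, hcard⟩, hor, -, hsrc⟩ := hp
  have hI' : ∀ B ∈ I, B ≠ S ∧ B ∈ p.1 ∧ ∀ B', ¬ p.2 B' B := by
    intro B hB
    have := hI hB
    simp only [otherSources, Finset.mem_filter, Finset.mem_erase] at this
    tauto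
  refine ⟨fun B hB => ?_, fun B hB => hcard B (hI' B hB).2.1 (hI' B hB).1,
    fun B hB => hdis B (hI' B hB).2.1 S hS (hI' B hB).1, fun B hB hc => ?_,
    fun B hB B' hB' h => ⟨hdis B (hI' B hB).2.1 B' (hI' B' hB').2.1 h, fun hc => ?_⟩⟩
  · rw [Finset.mem_powerset, Finset.subset_sdiff]
    refine ⟨?_, hdis B (hI' B hB).2.1 S hS (hI' B hB).1⟩
    rw [← hsup]
    exact Finset.le_sup (f := id) (hI' B hB).2.1
  · have := hor.2 B (hI' B hB).2.1 S hS (hI' B hB).1 hc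
    have h1 := hsrc B
    have h2 := (hI' B hB).2.2 S
    tauto
  · have := hor.2 B (hI' B hB).2.1 B' (hI' B' hB').2.1 h hc
    have h1 := (hI' B' hB').2.2 B
    have h2 := (hI' B hB).2.2 B'
    tauto

/-- Deleting the sources `S` and `I` leaves an acyclic orientation of a matching. -/
theorem orientedMatchings_of_orientedWithSource {n : ℕ} {S : Finset ℕ}
    {p : Finset (Finset ℕ) × (Finset ℕ → Finset ℕ → Prop)} (hp : p ∈ orientedWithSource n S)
    {I : Finset (Finset ℕ)} (hI : I ⊆ otherSources S p) :
    (p.1 \ insert S I, fun B B' => p.2 B B' ∧ B ∉ insert S I) ∈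
      orientedMatchings ((Finset.range n \ S) \ I.sup id) := by
  obtain ⟨⟨⟨hne, hdis, hsup⟩, hS, hcard⟩, hor, hac, hsrc⟩ := hp
  have hI' : ∀ B ∈ I, B ∈ p.1 ∧ ∀ B', ¬ p.2 B' B := by
    intro B hB
    have := hI hB
    simp only [otherSources, Finset.mem_filter, Finset.mem_erase] at this
    tauto
  have hJ : ∀ B ∈ insert S I, B ∈ p.1 ∧ ∀ B', ¬ p.2 B' B := by
    intro B hB
    rcases Finset.mem_insert.1 hB with rfl | h
    exacts [⟨hS, hsrc⟩, hI' B h]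
  refine ⟨⟨fun B hB => ?_, fun B hB B' hB' => ?_, ?_⟩, ⟨fun B B' h => ?_,
    fun B hB B' hB' hne hc => ?_⟩, fun B h => hac B (Relation.TransGen.mono (fun _ _ h => h.1) _ _ h)⟩
  · simp only [Finset.mem_sdiff, Finset.mem_insert, not_or] at hB
    exact hcard B hB.1 hB.2.1
  · exact hdis B (Finset.mem_sdiff.1 hB).1 B' (Finset.mem_sdiff.1 hB').1
  · ext x
    rw [← hsup]
    simp only [Finset.mem_sup, Finset.mem_sdiff, id]
    constructor
    · rintro ⟨B, ⟨hB, hBJ⟩, hx⟩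
      refine ⟨⟨⟨B, hB, hx⟩, fun hxS => ?_⟩, ?_⟩
      · exact Finset.disjoint_left.1 (hdis B hB S hS (by grind)) hx hxS
      · rintro ⟨B', hB', hx'⟩
        exact Finset.disjoint_left.1 (hdis B hB B' (hI' B' hB').1 (by grind)) hx hx'
    · rintro ⟨⟨⟨B, hB, hx⟩, hxS⟩, hxI⟩
      exact ⟨B, ⟨hB, by grind⟩, hx⟩
  · obtain ⟨h1, h2, h3, h4⟩ := hor.1 B B' h.1
    exact ⟨Finset.mem_sdiff.2 ⟨h1, h.2⟩,
      Finset.mem_sdiff.2 ⟨h2, fun h' => (hJ B' h').2 B h.1⟩, h3, h4⟩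
  · have := hor.2 B (Finset.mem_sdiff.1 hB).1 B' (Finset.mem_sdiff.1 hB').1 hne hc
    have h1 := (Finset.mem_sdiff.1 hB).2
    have h2 := (Finset.mem_sdiff.1 hB').2
    simp only [h1, h2, not_false_eq_true, and_true]
    exact this

/-- Adding `S` and `I` as sources to an acyclic orientation of a matching. -/
theorem orientedWithSource_of_orientedMatchings {n : ℕ} {S : Finset ℕ} (hSn : S ⊆ Finset.range n)
    (hSne : S.Nonempty) {I : Finset (Finset ℕ)} (hIn : I ⊆ (Finset.range n \ S).powerset)
    (hI : IsNoncrossingWith S I)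
    {q : Finset (Finset ℕ) × (Finset ℕ → Finset ℕ → Prop)}
    (hq : q ∈ orientedMatchings ((Finset.range n \ S) \ I.sup id)) :
    Disjoint q.1 (insert S I) ∧
    (q.1 ∪ insert S I,
      fun B B' => q.2 B B' ∨ (B ∈ insert S I ∧ B' ∈ q.1 ∧ Crosses B B')) ∈
        orientedWithSource n S ∧
    I ⊆ otherSources S (q.1 ∪ insert S I,
      fun B B' => q.2 B B' ∨ (B ∈ insert S I ∧ B' ∈ q.1 ∧ Crosses B B')) := by
  obtain ⟨⟨hcard, hdis, hsup⟩, hor, hac⟩ := hq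
  obtain ⟨hIc, hIS, hInS, hII⟩ := hI
  have hSI : S ∉ I := fun h => hSne.ne_empty (by simpa using hIS S h)
  have hJdis : ∀ B ∈ insert S I, ∀ B' ∈ insert S I, B ≠ B' →
      Disjoint B B' ∧ ¬ Crosses B B' := by
    intro B hB B' hB' hne
    rcases Finset.mem_insert.1 hB with rfl | h <;> rcases Finset.mem_insert.1 hB' with rfl | h'
    · exact absurd rfl hne
    · exact ⟨(hIS _ h').symm, fun hc => hInS _ h' hc.symm⟩
    · exact ⟨hIS _ h, hInS _ h⟩
    · exact hII B h B' h' hne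
  have hqU : ∀ B ∈ q.1, B ⊆ (Finset.range n \ S) \ I.sup id := by
    intro B hB
    rw [← hsup]
    exact Finset.le_sup (f := id) hB
  have hqJ : ∀ B ∈ q.1, ∀ B' ∈ insert S I, Disjoint B B' := by
    intro B hB B' hB'
    rw [Finset.disjoint_left]
    intro x hx hx'
    have := hqU B hB hx
    simp only [Finset.mem_sdiff, Finset.mem_sup, id, not_exists, not_and] at this
    rcases Finset.mem_insert.1 hB' with rfl | h
    exacts [this.1.2 hx', this.2 B' h hx']
  have hJne : ∀ B ∈ insert S I, B.Nonempty := by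
    intro B hB
    rcases Finset.mem_insert.1 hB with rfl | h
    · exact hSne
    · exact Finset.card_pos.1 (by rw [hIc B h]; norm_num)
  have hdisj : ∀ B ∈ q.1, B ∉ insert S I := fun B hB h =>
    (hJne B h).ne_empty (by simpa using hqJ B hB B h)
  have hsource : ∀ B ∈ insert S I, ∀ B',
      ¬ (q.2 B' B ∨ (B' ∈ insert S I ∧ B ∈ q.1 ∧ Crosses B' B)) := by
    rintro B hB B' (h | h)
    exacts [hdisj B (hor.1 _ _ h).2.1 hB, hdisj B h.2.1 hB]
  refine ⟨Finset.disjoint_left.2 hdisj,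
    ⟨⟨⟨?_, ?_, ?_⟩, ?_, ?_⟩, ⟨?_, ?_⟩, ?_, ?_⟩, ?_⟩
  · intro B hB
    rcases Finset.mem_union.1 hB with h | h
    · exact Finset.card_pos.1 (by rw [hcard B h]; norm_num)
    · exact hJne B h
  · intro B hB B' hB' hne
    rcases Finset.mem_union.1 hB with h | h <;> rcases Finset.mem_union.1 hB' with h' | h'
    exacts [hdis B h B' h' hne, hqJ B h B' h', (hqJ B' h' B h).symm, (hJdis B h B' h' hne).1]
  · rw [Finset.sup_union, hsup, Finset.sup_insert]
    have : I.sup id ⊆ Finset.range n \ S :=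
      Finset.sup_le fun B hB => Finset.mem_powerset.1 (hIn hB)
    ext x
    have h1 := @this x
    have h2 := @hSn x
    simp only [Finset.sup_eq_union, Finset.mem_union, Finset.mem_sdiff, id] at h1 h2 ⊢
    tauto
  · simp
  · intro B hB hBS
    rcases Finset.mem_union.1 hB with h | h
    · exact hcard B h
    · exact hIc B ((Finset.mem_insert.1 h).resolve_left hBS)
  · rintro B B' (h | ⟨h1, h2, h3⟩)
    · obtain ⟨h1, h2, h3, h4⟩ := hor.1 _ _ h
      exact ⟨Finset.mem_union_left _ h1, Finset.mem_union_left _ h2, h3, h4⟩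
    · exact ⟨Finset.mem_union_right _ h1, Finset.mem_union_left _ h2,
        fun h => hdisj B' h2 (h ▸ h1), h3⟩
  · intro B hB B' hB' hne hc
    rcases Finset.mem_union.1 hB with h | h <;> rcases Finset.mem_union.1 hB' with h' | h'
    · have := hor.2 B h B' h' hne hc
      have h1 := hdisj B h
      have h2 := hdisj B' h'
      simp only [h1, h2, false_and, or_false]
      exact this
    · exact iff_of_false (hsource B' h' B) (not_not.2 (Or.inr ⟨h', h, hc.symm⟩))
    · exact iff_of_true (Or.inr ⟨h, h', hc⟩) (hsource B h B')
    · exact absurd hc (hJdis B h B' h' hne).2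
  · intro B hB
    have key : ∀ C, Relation.TransGen
        (fun B B' => q.2 B B' ∨ (B ∈ insert S I ∧ B' ∈ q.1 ∧ Crosses B B')) B C →
        B ∈ insert S I ∨ Relation.TransGen q.2 B C := by
      intro C h
      by_cases hBJ : B ∈ insert S I
      · exact Or.inl hBJ
      refine Or.inr ?_
      induction h with
      | single h => exact .single (h.resolve_right fun h => hBJ h.1)
      | @tail D E hD h ih =>
        refine ih.tail (h.resolve_right fun h => ?_)
        obtain ⟨D', -, hD'⟩ := Relation.TransGen.tail'_iff.1 hD
        exact hsource D h.1 D' hD'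
    rcases key B hB with h | h
    · obtain ⟨D', -, hD'⟩ := Relation.TransGen.tail'_iff.1 hB
      exact hsource B h D' hD'
    · exact hac B h
  · exact hsource S (Finset.mem_insert_self _ _)
  · intro B hB
    simp only [otherSources, Finset.mem_filter, Finset.mem_erase]
    exact ⟨⟨fun h => hSI (h ▸ hB), Finset.mem_union_right _ (Finset.mem_insert_of_mem hB)⟩,
      hsource B (Finset.mem_insert_of_mem hB)⟩

theorem card_orientedWithSource_fiber {n : ℕ} {S : Finset ℕ} (hSn : S ⊆ Finset.range n)
    (hSne : S.Nonempty) {I : Finset (Finset ℕ)} (hIn : I ⊆ (Finset.range n \ S).powerset)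
    (hI : IsNoncrossingWith S I) :
    Nat.card {p // p ∈ orientedWithSource n S ∧ I ⊆ otherSources S p} =
      Nat.card (orientedMatchings ((Finset.range n \ S) \ I.sup id)) := by
  refine Nat.card_congr
    { toFun := fun p => ⟨_, orientedMatchings_of_orientedWithSource p.2.1 p.2.2⟩
      invFun := fun q =>
        ⟨_, (orientedWithSource_of_orientedMatchings hSn hSne hIn hI q.2).2⟩
      left_inv := ?_
      right_inv := ?_ }
  · rintro ⟨⟨ρ, r⟩, hp, hpI⟩
    have hJ : ∀ B ∈ insert S I, B ∈ ρ ∧ ∀ B', ¬ r B' B := by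
      intro B hB
      rcases Finset.mem_insert.1 hB with rfl | h
      · exact ⟨hp.1.2.1, hp.2.2.2⟩
      · have := hpI h
        simp only [otherSources, Finset.mem_filter, Finset.mem_erase] at this
        tauto
    obtain ⟨-, hor, -⟩ := hp
    refine Subtype.ext (Prod.ext (Finset.sdiff_union_of_subset fun B hB => (hJ B hB).1) ?_)
    funext B B'
    have h1 := hor.1 B B'
    have h2 := hor.2 B
    have h3 := hJ B
    have h4 := hJ B'
    simp only [Finset.mem_sdiff, eq_iff_iff]
    grind
  · rintro ⟨⟨ρ, r⟩, hq⟩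
    have hd := (orientedWithSource_of_orientedMatchings hSn hSne hIn hI hq).1
    refine Subtype.ext (Prod.ext ?_ ?_)
    · exact Finset.union_sdiff_cancel_right hd
    · funext B B'
      have h1 := hq.2.1.1 B B'
      have h2 : B ∈ ρ → B ∉ insert S I := fun h => Finset.disjoint_left.1 hd h
      simp only [eq_iff_iff]
      tauto

open Classical in
/-- Inclusion–exclusion over the set of sources. -/
theorem countA_eq_sum {n : ℕ} {S : Finset ℕ} (hSn : S ⊆ Finset.range n) (hSne : S.Nonempty) :
    (countA n S : ℤ) = ∑ I ∈ (Finset.range n \ S).powerset.powerset with IsNoncrossingWith S I,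
      (-1) ^ I.card * (Nat.card (orientedMatchings ((Finset.range n \ S) \ I.sup id)) : ℤ) := by
  set T := (orientedWithSource_finite n S).toFinset with hT
  have hmem : ∀ p, p ∈ T ↔ p ∈ orientedWithSource n S := fun p => by simp [hT]
  have hcount : countA n S = (T.filter fun p => otherSources S p = ∅).card := by
    rw [countA]
    refine Nat.subtype_card _ fun p => ?_
    rw [rootConnected_iff, Finset.mem_filter, hmem]
  rw [hcount, Finset.card_filter, Nat.cast_sum]
  calc ∑ p ∈ T, ((if otherSources S p = ∅ then 1 else 0 : ℕ) : ℤ)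
      = ∑ p ∈ T, ∑ I ∈ (otherSources S p).powerset, (-1 : ℤ) ^ I.card := by
        refine Finset.sum_congr rfl fun p _ => ?_
        rw [Finset.sum_powerset_neg_one_pow_card]
        push_cast
        rfl
    _ = ∑ p ∈ T, ∑ I ∈ (Finset.range n \ S).powerset.powerset with IsNoncrossingWith S I,
          if I ⊆ otherSources S p then (-1 : ℤ) ^ I.card else 0 := by
        refine Finset.sum_congr rfl fun p hp => ?_
        rw [← Finset.sum_filter]
        refine Finset.sum_congr ?_ fun _ _ => rfl
        ext I
        simp only [Finset.mem_filter, Finset.mem_powerset (s := I)]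
        exact ⟨fun h => ⟨isNoncrossingWith_of_subset_otherSources ((hmem p).1 hp) h, h⟩,
          fun h => h.2⟩
    _ = _ := by
        rw [Finset.sum_comm]
        refine Finset.sum_congr rfl fun I hI => ?_
        rw [Finset.mem_filter, Finset.mem_powerset] at hI
        rw [← card_orientedWithSource_fiber hSn hSne hI.1 hI.2, ← Finset.sum_filter,
          Finset.sum_const, nsmul_eq_mul, mul_comm]
        congr 2
        symm
        refine Nat.subtype_card _ fun p => ?_
        rw [Finset.mem_filter, hmem]

theorem mem_finsetCongr_iff {α β : Type*} (e : α ≃ β) (s : Finset α) (b : β) :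
    b ∈ e.finsetCongr s ↔ ∃ a ∈ s, e a = b :=
  Finset.mem_map

theorem orientedMatchings_finite (U : Finset ℕ) : (orientedMatchings U).Finite := by
  refine (finite_orientations U.powerset).subset ?_
  rintro p ⟨⟨-, -, h⟩, hr, -⟩
  refine ⟨fun B hB => ?_, hr⟩
  rw [Finset.mem_powerset, ← h]
  exact Finset.le_sup (f := id) hB

theorem crosses_map_iff {e : ℕ ≃ ℕ} {U B B' : Finset ℕ} (he : StrictMonoOn e U)
    (hB : B ⊆ U) (hB' : B' ⊆ U) :
    Crosses (e.finsetCongr B) (e.finsetCongr B') ↔ Crosses B B' := by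
  have hlt : ∀ x ∈ U, ∀ y ∈ U, (e x < e y ↔ x < y) := fun x hx y hy => he.lt_iff_lt hx hy
  simp only [Crosses, Equiv.finsetCongr_apply, Finset.mem_map, Equiv.coe_toEmbedding,
    exists_exists_and_eq_and]
  constructor
  · rintro ⟨i, hi, k, hk, j, hj, l, hl, h⟩
    refine ⟨i, hi, k, hk, j, hj, l, hl, ?_⟩
    simpa only [gt_iff_lt, hlt _ (hB hi) _ (hB' hj), hlt _ (hB' hj) _ (hB hk),
      hlt _ (hB hk) _ (hB' hl), hlt _ (hB' hj) _ (hB hi), hlt _ (hB hk) _ (hB' hj),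
      hlt _ (hB' hl) _ (hB hk)] using h
  · rintro ⟨i, hi, k, hk, j, hj, l, hl, h⟩
    refine ⟨i, hi, k, hk, j, hj, l, hl, ?_⟩
    simpa only [gt_iff_lt, hlt _ (hB hi) _ (hB' hj), hlt _ (hB' hj) _ (hB hk),
      hlt _ (hB hk) _ (hB' hl), hlt _ (hB' hj) _ (hB hi), hlt _ (hB hk) _ (hB' hj),
      hlt _ (hB' hl) _ (hB hk)] using h

theorem exists_perm_strictMonoOn {U V : Finset ℕ} (h : U.card = V.card) :
    ∃ e : ℕ ≃ ℕ, StrictMonoOn e U ∧ U.map e.toEmbedding = V := by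
  classical
  let f : U ≃o V := (U.orderIsoOfFin h).symm.trans (V.orderIsoOfFin rfl)
  obtain ⟨g⟩ : Nonempty ({x // x ∉ U} ≃ {x // x ∉ V}) := by
    have hinf : ∀ W : Finset ℕ, Infinite {x // x ∉ W} := fun W =>
      (W.finite_toSet.infinite_compl).to_subtype
    have := hinf U
    have := hinf V
    exact nonempty_equiv_of_countable
  let e : ℕ ≃ ℕ := ((Equiv.sumCompl (· ∈ U)).symm.trans
    (Equiv.sumCongr f.toEquiv g)).trans (Equiv.sumCompl (· ∈ V))
  have he : ∀ x (hx : x ∈ U), e x = f ⟨x, hx⟩ := fun x hx => by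
    simp [e, Equiv.sumCompl_symm_apply_of_pos hx]
  refine ⟨e, fun x hx y hy hxy => ?_, ?_⟩
  · rw [he x hx, he y hy]
    exact f.strictMono hxy
  · refine Finset.eq_of_subset_of_card_le (fun y hy => ?_) (by rw [Finset.card_map, h])
    obtain ⟨x, hx, rfl⟩ := Finset.mem_map.1 hy
    rw [Equiv.coe_toEmbedding, he x hx]
    exact (f ⟨x, hx⟩).2

theorem card_orientedMatchings_le {U V : Finset ℕ} (h : U.card = V.card) :
    Nat.card (orientedMatchings U) ≤ Nat.card (orientedMatchings V) := by
  obtain ⟨e, he, rfl⟩ := exists_perm_strictMonoOn h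
  have := (orientedMatchings_finite (U.map e.toEmbedding)).to_subtype
  have hmaps : ∀ p ∈ orientedMatchings U,
      (e.finsetCongr.finsetCongr p.1,
        fun B B' => p.2 (e.finsetCongr.symm B) (e.finsetCongr.symm B')) ∈
        orientedMatchings (U.map e.toEmbedding) := by
    rintro ⟨ρ, r⟩ ⟨⟨hcard, hdis, hsup⟩, hor, hac⟩
    have hsub : ∀ B ∈ ρ, B ⊆ U := fun B hB => hsup ▸ Finset.le_sup (f := id) hB
    have hmem : ∀ B, B ∈ e.finsetCongr.finsetCongr ρ ↔ ∃ C ∈ ρ, e.finsetCongr C = B :=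
      mem_finsetCongr_iff _ _
    refine ⟨⟨?_, ?_, ?_⟩, ⟨?_, ?_⟩, fun B h => hac (e.finsetCongr.symm B) ?_⟩
    · intro B hB
      obtain ⟨C, hC, rfl⟩ := (hmem B).1 hB
      simpa using hcard C hC
    · intro B hB B' hB' hne
      obtain ⟨C, hC, rfl⟩ := (hmem B).1 hB
      obtain ⟨C', hC', rfl⟩ := (hmem B').1 hB'
      simpa [Equiv.finsetCongr_apply] using hdis C hC C' hC' (by rintro rfl; exact hne rfl)
    · ext x
      rw [← hsup]
      simp only [Finset.mem_sup, hmem, id, Finset.mem_map, Equiv.coe_toEmbedding]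
      constructor
      · rintro ⟨B, ⟨C, hC, rfl⟩, hx⟩
        simp only [Equiv.finsetCongr_apply, Finset.mem_map, Equiv.coe_toEmbedding] at hx
        obtain ⟨y, hy, rfl⟩ := hx
        exact ⟨y, ⟨C, hC, hy⟩, rfl⟩
      · rintro ⟨y, ⟨C, hC, hy⟩, rfl⟩
        exact ⟨_, ⟨C, hC, rfl⟩, by simpa [Equiv.finsetCongr_apply] using hy⟩
    · intro B B' hr
      obtain ⟨C, rfl⟩ := e.finsetCongr.surjective B
      obtain ⟨C', rfl⟩ := e.finsetCongr.surjective B'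
      simp only [Equiv.symm_apply_apply] at hr
      obtain ⟨h1, h2, h3, h4⟩ := hor.1 _ _ hr
      exact ⟨(hmem _).2 ⟨C, h1, rfl⟩, (hmem _).2 ⟨C', h2, rfl⟩,
        e.finsetCongr.injective.ne h3, (crosses_map_iff he (hsub _ h1) (hsub _ h2)).2 h4⟩
    · intro B hB B' hB' hne hc
      obtain ⟨C, hC, rfl⟩ := (hmem B).1 hB
      obtain ⟨C', hC', rfl⟩ := (hmem B').1 hB'
      simp only [Equiv.symm_apply_apply]
      exact hor.2 C hC C' hC' (by rintro rfl; exact hne rfl)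
        ((crosses_map_iff he (hsub _ hC) (hsub _ hC')).1 hc)
    · exact Relation.TransGen.lift e.finsetCongr.symm (fun _ _ h => h) _ _ h
  refine Nat.card_le_card_of_injective (fun p => ⟨_, hmaps p.1 p.2⟩) ?_
  rintro ⟨⟨ρ, r⟩, hp⟩ ⟨⟨ρ', r'⟩, hp'⟩ heq
  simp only [Subtype.mk.injEq, Prod.mk.injEq, EmbeddingLike.apply_eq_iff_eq] at heq
  obtain ⟨rfl, heq⟩ := heq
  refine Subtype.ext (Prod.ext rfl ?_)
  funext B B'
  simpa only [Equiv.symm_apply_apply] using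
    congrFun (congrFun heq (e.finsetCongr B)) (e.finsetCongr B')

/-- The number of oriented matchings depends only on the number of points. -/
theorem card_orientedMatchings_congr {U V : Finset ℕ} (h : U.card = V.card) :
    Nat.card (orientedMatchings U) = Nat.card (orientedMatchings V) :=
  (card_orientedMatchings_le h).antisymm (card_orientedMatchings_le h.symm)

theorem IsNoncrossingWith.card_sdiff {n : ℕ} {S : Finset ℕ} (hSn : S ⊆ Finset.range n)
    {I : Finset (Finset ℕ)} (hIn : I ⊆ (Finset.range n \ S).powerset)
    (hI : IsNoncrossingWith S I) :
    ((Finset.range n \ S) \ I.sup id).card = n - S.card - 2 * I.card := by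
  have hsup : (I.sup id).card = 2 * I.card := by
    rw [Finset.sup_eq_biUnion, 
      Finset.card_biUnion (t := id) fun B hB B' hB' h => (hI.2.2.2 B hB B' hB' h).1,
      Finset.sum_const_nat (f := fun B : Finset ℕ => (id B).card) hI.1, mul_comm]
  rw [Finset.card_sdiff_of_subset (Finset.sup_le (f := id) fun B hB => Finset.mem_powerset.1 (hIn hB)),
    Finset.card_sdiff_of_subset hSn, Finset.card_range, hsup]

/-- A permutation of the points preserving the noncrossing conditions preserves `countA`. -/
theorem countA_map_eq {n : ℕ} {S : Finset ℕ} (hSn : S ⊆ Finset.range n) (hSne : S.Nonempty)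
    {e : ℕ ≃ ℕ} (hen : ∀ x, e x < n ↔ x < n)
    (hmap : ∀ I ⊆ (Finset.range n \ S).powerset, IsNoncrossingWith S I →
      IsNoncrossingWith (e.finsetCongr S) (e.finsetCongr.finsetCongr I))
    (hmap' : ∀ I ⊆ (Finset.range n \ e.finsetCongr S).powerset,
      IsNoncrossingWith (e.finsetCongr S) I →
      IsNoncrossingWith S (e.finsetCongr.finsetCongr.symm I)) :
    countA n S = countA n (e.finsetCongr S) := by
  have hrange : e.finsetCongr (Finset.range n) = Finset.range n := by
    ext x
    obtain ⟨y, rfl⟩ := e.surjective x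
    simp [Equiv.finsetCongr_apply, hen]
  have hSn' : e.finsetCongr S ⊆ Finset.range n := by
    rw [← hrange]
    exact Finset.map_subset_map.2 hSn
  have hpow : ∀ I, e.finsetCongr.finsetCongr I ⊆ (Finset.range n \ e.finsetCongr S).powerset ↔
      I ⊆ (Finset.range n \ S).powerset := by
    intro I
    have h1 : e.finsetCongr (Finset.range n \ S) = Finset.range n \ e.finsetCongr S := by
      conv_rhs => rw [← hrange]
      exact Finset.map_sdiff _ _
    have h2 : e.finsetCongr.finsetCongr (Finset.range n \ S).powerset =
        (Finset.range n \ e.finsetCongr S).powerset := by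
      rw [← h1]
      ext B
      obtain ⟨C, rfl⟩ := e.finsetCongr.surjective B
      rw [mem_finsetCongr_iff]
      simp only [EmbeddingLike.apply_eq_iff_eq, exists_eq_right, Finset.mem_powerset]
      exact Finset.map_subset_map.symm
    rw [← h2]
    exact Finset.map_subset_map
  classical
  have key : (countA n S : ℤ) = countA n (e.finsetCongr S) := by
    rw [countA_eq_sum hSn hSne, countA_eq_sum hSn' (by simpa [Equiv.finsetCongr_apply] using hSne)]
    refine Finset.sum_nbij' e.finsetCongr.finsetCongr e.finsetCongr.finsetCongr.symm ?_ ?_ ?_ ?_ ?_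
    · intro I hI
      rw [Finset.mem_filter, Finset.mem_powerset] at hI ⊢
      exact ⟨(hpow I).2 hI.1, hmap I hI.1 hI.2⟩
    · intro I hI
      rw [Finset.mem_filter, Finset.mem_powerset] at hI ⊢
      refine ⟨(hpow _).1 ?_, hmap' I hI.1 hI.2⟩
      rw [Equiv.apply_symm_apply]
      exact hI.1
    · exact fun I _ => Equiv.symm_apply_apply _ _
    · exact fun I _ => Equiv.apply_symm_apply _ _
    · intro I hI
      rw [Finset.mem_filter, Finset.mem_powerset] at hI
      have hcard : (e.finsetCongr.finsetCongr I).card = I.card := by simp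
      have hcardS : (e.finsetCongr S).card = S.card := by simp
      rw [hcard, card_orientedMatchings_congr]
      rw [hI.2.card_sdiff hSn hI.1,
        (hmap I hI.1 hI.2).card_sdiff hSn' ((hpow I).2 hI.1), hcard, hcardS]
  exact_mod_cast key

/-- `Crosses`, with the points compared through a key function. -/
def KeyCrosses (f : ℕ → ℤ) (B B' : Finset ℕ) : Prop :=
  ∃ i ∈ B, ∃ k ∈ B, ∃ j ∈ B', ∃ l ∈ B',
    (f i < f j ∧ f j < f k ∧ f k < f l) ∨ (f i > f j ∧ f j > f k ∧ f k > f l)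

theorem crosses_iff_keyCrosses_cast (B B' : Finset ℕ) :
    Crosses B B' ↔ KeyCrosses (fun x => (x : ℤ)) B B' := by
  simp [Crosses, KeyCrosses]

/-- Crossing is invariant under cyclic rotation of the keys. -/
theorem KeyCrosses.rotate {f g : ℕ → ℤ} {n t : ℤ} {B B' : Finset ℕ}
    (hB : ∀ x ∈ B, 0 ≤ f x ∧ f x < n ∧ g x = if t ≤ f x then f x - t else f x - t + n)
    (hB' : ∀ x ∈ B', 0 ≤ f x ∧ f x < n ∧ g x = if t ≤ f x then f x - t else f x - t + n)
    (h : KeyCrosses f B B') : KeyCrosses g B B' := by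
  obtain ⟨i, hi, k, hk, j, hj, l, hl, h⟩ := h
  have hi' := hB i hi
  have hk' := hB k hk
  have hj' := hB' j hj
  have hl' := hB' l hl
  rcases h with h | h <;> split_ifs at hi' hk' hj' hl' <;> first
    | exact ⟨i, hi, k, hk, j, hj, l, hl, .inl (by omega)⟩
    | exact ⟨i, hi, k, hk, j, hj, l, hl, .inr (by omega)⟩
    | exact ⟨k, hk, i, hi, j, hj, l, hl, .inl (by omega)⟩
    | exact ⟨k, hk, i, hi, j, hj, l, hl, .inr (by omega)⟩
    | exact ⟨i, hi, k, hk, l, hl, j, hj, .inl (by omega)⟩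
    | exact ⟨i, hi, k, hk, l, hl, j, hj, .inr (by omega)⟩
    | exact ⟨k, hk, i, hi, l, hl, j, hj, .inl (by omega)⟩
    | exact ⟨k, hk, i, hi, l, hl, j, hj, .inr (by omega)⟩

/-- Position of `x` on the circle `ℤ/n`, measured from `lo`. -/
def arcPos (n : ℕ) (lo : ℤ) (x : ℕ) : ℤ := (x - lo) % n

theorem arcPos_eq {n x : ℕ} (lo : ℤ) (hx : x < n) :
    arcPos n lo x = if lo % n ≤ x then x - lo % n else x - lo % n + n := by
  have hn : (0 : ℤ) < n := by omega
  have h1 := Int.emod_nonneg lo hn.ne'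
  have h2 := Int.emod_lt_of_pos lo hn
  rw [arcPos, ← Int.sub_emod_emod]
  split_ifs with h
  · exact Int.emod_eq_of_lt (by omega) (by omega)
  · rw [← Int.add_emod_right]
    exact Int.emod_eq_of_lt (by omega) (by omega)

theorem crosses_iff_arcPos {n : ℕ} (lo : ℤ) {B B' : Finset ℕ} (hB : B ⊆ Finset.range n)
    (hB' : B' ⊆ Finset.range n) : Crosses B B' ↔ KeyCrosses (arcPos n lo) B B' := by
  rw [crosses_iff_keyCrosses_cast]
  have hlt : ∀ {C : Finset ℕ}, C ⊆ Finset.range n → ∀ x ∈ C, x < n :=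
    fun hC x hx => Finset.mem_range.1 (hC hx)
  constructor
  · intro h
    refine h.rotate (n := n) (t := lo % n) (fun x hx => ?_) fun x hx => ?_
    · exact ⟨by omega, by have := hlt hB x hx; omega, arcPos_eq lo (hlt hB x hx)⟩
    · exact ⟨by omega, by have := hlt hB' x hx; omega, arcPos_eq lo (hlt hB' x hx)⟩
  · have main : ∀ x < n, 0 ≤ arcPos n lo x ∧ arcPos n lo x < n ∧
        (x : ℤ) = if n - lo % n ≤ arcPos n lo x then arcPos n lo x - (n - lo % n)
          else arcPos n lo x - (n - lo % n) + n := by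
      intro x hx
      have hn : (0 : ℤ) < n := by omega
      have h1 := Int.emod_nonneg lo hn.ne'
      have h2 := Int.emod_lt_of_pos lo hn
      have h3 := arcPos_eq lo hx
      split_ifs at h3 ⊢ <;> omega
    intro h
    exact h.rotate (n := n) (t := n - lo % n) (fun x hx => main x (hlt hB x hx))
      fun x hx => main x (hlt hB' x hx)

theorem arcPos_bounds {n x : ℕ} (lo : ℤ) (hx : x < n) :
    0 ≤ arcPos n lo x ∧ arcPos n lo x < n :=
  ⟨Int.emod_nonneg _ (by omega), Int.emod_lt_of_pos _ (by omega)⟩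

theorem arcPos_injOn {n x y : ℕ} {lo : ℤ} (hx : x < n) (hy : y < n)
    (h : arcPos n lo x = arcPos n lo y) : x = y := by
  rw [arcPos_eq lo hx, arcPos_eq lo hy] at h
  split_ifs at h <;> omega

theorem arcPos_toNat {n : ℕ} (hn : 0 < n) (lo y : ℤ) :
    arcPos n lo (y % n).toNat = (y - lo) % n := by
  rw [arcPos, Int.toNat_of_nonneg (Int.emod_nonneg _ (by omega)), Int.emod_sub_emod]

/-- Reflection of the arc from `lo` to `hi` of the circle `ℤ/n`, fixing the other points. -/
def reflectArc (n : ℕ) (lo hi : ℤ) (x : ℕ) : ℕ :=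
  if x < n ∧ arcPos n lo x ≤ hi - lo then ((hi - arcPos n lo x) % n).toNat else x

theorem reflectArc_lt {n : ℕ} (lo hi : ℤ) {x : ℕ} (hx : x < n) : reflectArc n lo hi x < n := by
  unfold reflectArc
  split_ifs
  · have := Int.emod_lt_of_pos (hi - arcPos n lo x) (b := n) (by omega)
    omega
  · exact hx

theorem arcPos_reflectArc {n : ℕ} {lo hi : ℤ} (h' : hi - lo ≤ n) {x : ℕ}
    (hx : x < n) :
    arcPos n lo (reflectArc n lo hi x) =
      if arcPos n lo x ≤ hi - lo ∧ ¬ (hi - lo = n ∧ arcPos n lo x = 0) then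
        hi - lo - arcPos n lo x else arcPos n lo x := by
  have hb := arcPos_bounds lo hx
  by_cases hle : arcPos n lo x ≤ hi - lo
  · rw [reflectArc, if_pos ⟨hx, hle⟩, arcPos_toNat (by omega), sub_right_comm]
    split_ifs with hc
    · exact Int.emod_eq_of_lt (by omega) (by omega)
    · obtain ⟨h1, h2⟩ : hi - lo = n ∧ arcPos n lo x = 0 := by tauto
      rw [h1, h2, sub_zero, Int.emod_self]
  · rw [reflectArc, if_neg (by tauto), if_neg (by tauto)]

theorem reflectArc_involutive {n : ℕ} {lo hi : ℤ} (h' : hi - lo ≤ n) :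
    Function.Involutive (reflectArc n lo hi) := by
  intro x
  by_cases hx : x < n
  · have h1 := reflectArc_lt lo hi hx
    refine arcPos_injOn (lo := lo) (reflectArc_lt lo hi h1) hx ?_
    have hb := arcPos_bounds lo hx
    rw [arcPos_reflectArc h' h1, arcPos_reflectArc h' hx]
    split_ifs <;> omega
  · have : reflectArc n lo hi x = x := if_neg (by tauto)
    rw [this, this]

/-- `S` contains both end points of the arc from `lo` to `hi`. -/
def HasEnds (n : ℕ) (lo hi : ℤ) (S : Finset ℕ) : Prop :=
  (∃ s ∈ S, arcPos n lo s = 0) ∧ (hi - lo < n → ∃ s ∈ S, arcPos n lo s = hi - lo)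

theorem HasEnds.le {n : ℕ} {lo hi : ℤ} {S : Finset ℕ} (hends : HasEnds n lo hi S)
    (hS : S ⊆ Finset.range n) : lo ≤ hi := by
  by_contra! h
  obtain ⟨t, ht, ht0⟩ := hends.2 (by omega)
  have := arcPos_bounds lo (Finset.mem_range.1 (hS ht))
  omega

theorem inside_or_outside {n : ℕ} {lo hi : ℤ} (h' : hi - lo ≤ n) {S B : Finset ℕ}
    (hS : S ⊆ Finset.range n) (hends : HasEnds n lo hi S) (hB : B ⊆ Finset.range n)
    (hBS : Disjoint B S) (hc : ¬ Crosses B S) :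
    (∀ x ∈ B, 0 < arcPos n lo x ∧ arcPos n lo x < hi - lo) ∨
      ∀ x ∈ B, hi - lo < arcPos n lo x := by
  obtain ⟨⟨s, hs, hs0⟩, hends⟩ := hends
  have hne : ∀ x ∈ B, ∀ y ∈ S, arcPos n lo x ≠ arcPos n lo y := fun x hx y hy heq =>
    Finset.disjoint_left.1 hBS hx
      (arcPos_injOn (Finset.mem_range.1 (hB hx)) (Finset.mem_range.1 (hS hy)) heq ▸ hy)
  have hpos : ∀ x ∈ B, 0 < arcPos n lo x := fun x hx => by
    have h1 := hne x hx s hs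
    have h2 := arcPos_bounds lo (Finset.mem_range.1 (hB hx))
    omega
  by_contra! hcon
  obtain ⟨⟨x, hx, hx1⟩, y, hy, hy1⟩ := hcon
  have hx2 := hx1 (hpos x hx)
  have hbx := arcPos_bounds lo (Finset.mem_range.1 (hB hx))
  obtain ⟨t, ht, ht0⟩ := hends (by omega)
  have h1 := hne x hx t ht
  have h2 := hne y hy t ht
  have h3 := hpos y hy
  rw [crosses_iff_arcPos lo hB hS] at hc
  exact hc ⟨x, hx, y, hy, t, ht, s, hs, .inr (by omega)⟩

section Reflection

variable {n : ℕ} {lo hi : ℤ} {e : ℕ ≃ ℕ}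

theorem finsetCongr_subset_range (he : ⇑e = reflectArc n lo hi) {B : Finset ℕ}
    (hB : B ⊆ Finset.range n) : e.finsetCongr B ⊆ Finset.range n := by
  intro x hx
  obtain ⟨y, hy, rfl⟩ := (mem_finsetCongr_iff _ _ _).1 hx
  rw [he, Finset.mem_range]
  exact reflectArc_lt _ _ (Finset.mem_range.1 (hB hy))

theorem keyCrosses_finsetCongr_iff (he : ⇑e = reflectArc n lo hi) {B B' : Finset ℕ} :
    KeyCrosses (arcPos n lo) (e.finsetCongr B) (e.finsetCongr B') ↔
      KeyCrosses (fun x => arcPos n lo (reflectArc n lo hi x)) B B' := by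
  simp only [KeyCrosses, Equiv.finsetCongr_apply, Finset.mem_map, Equiv.coe_toEmbedding,
    exists_exists_and_eq_and, he]

theorem not_crosses_reflect_source (h' : hi - lo ≤ n)
    (he : ⇑e = reflectArc n lo hi) {S B : Finset ℕ}
    (hS : S ⊆ Finset.range n) (hends : HasEnds n lo hi S) (hB : B ⊆ Finset.range n)
    (hBS : Disjoint B S) (hc : ¬ Crosses B S) :
    ¬ Crosses (e.finsetCongr B) (e.finsetCongr S) := by
  have hside := inside_or_outside h' hS hends hB hBS hc
  rw [crosses_iff_arcPos lo (finsetCongr_subset_range he hB) (finsetCongr_subset_range he hS),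
    keyCrosses_finsetCongr_iff he]
  rw [crosses_iff_arcPos lo hB hS] at hc
  rintro ⟨i, hi, k, hk, j, hj, l, hl, hcr⟩
  obtain ⟨s, hs, hs0⟩ := hends.1
  have bound : ∀ x ∈ B, x < n := fun x hx => Finset.mem_range.1 (hB hx)
  have bound' : ∀ x ∈ S, x < n := fun x hx => Finset.mem_range.1 (hS hx)
  simp only [arcPos_reflectArc h' (bound _ hi), arcPos_reflectArc h' (bound _ hk),
    arcPos_reflectArc h' (bound' _ hj), arcPos_reflectArc h' (bound' _ hl)] at hcr
  have bi := arcPos_bounds lo (bound _ hi)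
  have bk := arcPos_bounds lo (bound _ hk)
  have bj := arcPos_bounds lo (bound' _ hj)
  have hle := hends.le hS
  have hik : (arcPos n lo i > arcPos n lo j ∧ arcPos n lo j > arcPos n lo k ∧
        arcPos n lo k > arcPos n lo s) ∨
      (arcPos n lo k > arcPos n lo j ∧ arcPos n lo j > arcPos n lo i ∧
        arcPos n lo i > arcPos n lo s) := by
    rcases hside with hside | hside
    · have h1 := hside i hi
      have h2 := hside k hk
      split_ifs at hcr <;> omega
    · have h1 := hside i hi
      have h2 := hside k hk
      split_ifs at hcr <;> omega
  rcases hik with hik | hik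
  · exact hc ⟨i, hi, k, hk, j, hj, s, hs, .inr hik⟩
  · exact hc ⟨k, hk, i, hi, j, hj, s, hs, .inr hik⟩

theorem not_crosses_reflect (h' : hi - lo ≤ n)
    (he : ⇑e = reflectArc n lo hi) {S B B' : Finset ℕ}
    (hS : S ⊆ Finset.range n) (hends : HasEnds n lo hi S) (hB : B ⊆ Finset.range n)
    (hBS : Disjoint B S) (hc : ¬ Crosses B S) (hB' : B' ⊆ Finset.range n)
    (hBS' : Disjoint B' S) (hc' : ¬ Crosses B' S) (hBB' : ¬ Crosses B B') :
    ¬ Crosses (e.finsetCongr B) (e.finsetCongr B') := by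
  have hside := inside_or_outside h' hS hends hB hBS hc
  have hside' := inside_or_outside h' hS hends hB' hBS' hc'
  rw [crosses_iff_arcPos lo (finsetCongr_subset_range he hB) (finsetCongr_subset_range he hB'),
    keyCrosses_finsetCongr_iff he]
  rw [crosses_iff_arcPos lo hB hB'] at hBB'
  rintro ⟨i, hi, k, hk, j, hj, l, hl, hcr⟩
  have bound : ∀ x ∈ B, x < n := fun x hx => Finset.mem_range.1 (hB hx)
  have bound' : ∀ x ∈ B', x < n := fun x hx => Finset.mem_range.1 (hB' hx)
  simp only [arcPos_reflectArc h' (bound _ hi), arcPos_reflectArc h' (bound _ hk),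
    arcPos_reflectArc h' (bound' _ hj), arcPos_reflectArc h' (bound' _ hl)] at hcr
  refine hBB' ⟨i, hi, k, hk, j, hj, l, hl, ?_⟩
  have bi := arcPos_bounds lo (bound _ hi)
  rcases hside with hside | hside <;> rcases hside' with hside' | hside' <;>
  · have h1 := hside i hi
    have h2 := hside k hk
    have h3 := hside' j hj
    have h4 := hside' l hl
    split_ifs at hcr <;> omega

theorem IsNoncrossingWith.reflect (h' : hi - lo ≤ n)
    (he : ⇑e = reflectArc n lo hi) {S : Finset ℕ} (hS : S ⊆ Finset.range n)
    (hends : HasEnds n lo hi S) {I : Finset (Finset ℕ)}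
    (hIn : I ⊆ (Finset.range n \ S).powerset) (hI : IsNoncrossingWith S I) :
    IsNoncrossingWith (e.finsetCongr S) (e.finsetCongr.finsetCongr I) := by
  have hIr : ∀ B ∈ I, B ⊆ Finset.range n := fun B hB =>
    (Finset.mem_powerset.1 (hIn hB)).trans Finset.sdiff_subset
  have hmem := mem_finsetCongr_iff e.finsetCongr I
  have hdisj : ∀ {B C : Finset ℕ}, Disjoint B C → Disjoint (e.finsetCongr B) (e.finsetCongr C) :=
    fun hd => (Finset.disjoint_map _).2 hd
  obtain ⟨h1, h2, h3, h4⟩ := hI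
  refine ⟨fun B hB => ?_, fun B hB => ?_, fun B hB => ?_, fun B hB B' hB' hne => ?_⟩
  · obtain ⟨C, hC, rfl⟩ := (hmem B).1 hB
    simpa using h1 C hC
  · obtain ⟨C, hC, rfl⟩ := (hmem B).1 hB
    exact hdisj (h2 C hC)
  · obtain ⟨C, hC, rfl⟩ := (hmem B).1 hB
    exact not_crosses_reflect_source h' he hS hends (hIr C hC) (h2 C hC) (h3 C hC)
  · obtain ⟨C, hC, rfl⟩ := (hmem B).1 hB
    obtain ⟨C', hC', rfl⟩ := (hmem B').1 hB'
    obtain ⟨h5, h6⟩ := h4 C hC C' hC' (by rintro rfl; exact hne rfl)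
    exact ⟨hdisj h5, not_crosses_reflect h' he hS hends (hIr C hC) (h2 C hC) (h3 C hC)
      (hIr C' hC') (h2 C' hC') (h3 C' hC') h6⟩

theorem HasEnds.reflect (h' : hi - lo ≤ n)
    (he : ⇑e = reflectArc n lo hi) {S : Finset ℕ} (hS : S ⊆ Finset.range n)
    (hends : HasEnds n lo hi S) : HasEnds n lo hi (e.finsetCongr S) := by
  obtain ⟨⟨s, hs, hs0⟩, ht⟩ := hends
  have hmem : ∀ x ∈ S, reflectArc n lo hi x ∈ e.finsetCongr S := fun x hx =>
    (mem_finsetCongr_iff _ _ _).2 ⟨x, hx, by rw [he]⟩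
  have hs1 := arcPos_reflectArc h' (Finset.mem_range.1 (hS hs))
  by_cases hlt : hi - lo < n
  · obtain ⟨t, ht, ht0⟩ := ht hlt
    have ht1 := arcPos_reflectArc h' (Finset.mem_range.1 (hS ht))
    have ht2 := arcPos_bounds lo (Finset.mem_range.1 (hS ht))
    refine ⟨⟨_, hmem t ht, ?_⟩, fun _ => ⟨_, hmem s hs, ?_⟩⟩
    · rw [ht1, if_pos (by omega)]; omega
    · rw [hs1, if_pos (by omega)]; omega
  · refine ⟨⟨_, hmem s hs, ?_⟩, fun h => absurd h hlt⟩
    rw [hs1, if_neg (by omega)]; omega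

end Reflection

theorem countA_reflectArc {n : ℕ} {lo hi : ℤ} (h' : hi - lo ≤ n) {S : Finset ℕ}
    (hS : S ⊆ Finset.range n) (hends : HasEnds n lo hi S) :
    countA n S = countA n (S.image (reflectArc n lo hi)) := by
  set e : ℕ ≃ ℕ := (reflectArc_involutive h').toPerm with he
  have hcoe : ⇑e = reflectArc n lo hi := rfl
  have hsymm : e.symm = e := Function.Involutive.toPerm_symm _
  have himage : S.image (reflectArc n lo hi) = e.finsetCongr S := by
    ext x
    rw [mem_finsetCongr_iff, Finset.mem_image, hcoe]
  have hinv : ∀ B, e.finsetCongr (e.finsetCongr B) = B := fun B => by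
    conv_lhs => enter [1]; rw [← hsymm]
    rw [← Equiv.finsetCongr_symm, Equiv.symm_apply_apply]
  rw [himage]
  refine countA_map_eq hS (hends.1.imp fun _ h => h.1) (fun x => ⟨fun hx => ?_, fun hx => ?_⟩)
    (fun I hIn hI => hI.reflect h' hcoe hS hends hIn) fun I hIn hI => ?_
  · have := reflectArc_lt lo hi hx
    rwa [hcoe, reflectArc_involutive h' x] at this
  · exact reflectArc_lt lo hi hx
  · have := hI.reflect h' hcoe (finsetCongr_subset_range hcoe hS)
      (hends.reflect h' hcoe hS) hIn
    rwa [hinv, ← hsymm, ← Equiv.finsetCongr_symm, ← Equiv.finsetCongr_symm] at this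

/-- Reflection invariance: with cyclic conventions `a_0 = a_m - n` and
`a_{m+1} = a_1 + n`, replacing `a_j` by its reflection
`a_{j+1} + a_{j-1} - a_j` across the midpoint of `a_{j-1}, a_{j+1}` does not
change `A_{k+1}` (elements taken mod `n` to account for wrap-around). -/
theorem countA_reflection (m k n : ℕ) (hm : 2 ≤ m) (hn : n = m + 2 * k)
    (a : ℕ → ℤ) (hmono : StrictMonoOn a (Set.Icc 1 m))
    (h0 : a 0 = a m - n) (htop : a (m + 1) = a 1 + n)
    (h1 : 0 ≤ a 1) (hmn : a m < n)
    (j : ℕ) (hj1 : 1 ≤ j) (hjm : j ≤ m) :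
    countA n ((Finset.Icc 1 m).image fun i => ((a i % (n : ℤ)).toNat))
      = countA n ((Finset.Icc 1 m).image fun i =>
          (((Function.update a j (a (j + 1) + a (j - 1) - a j)) i % (n : ℤ)).toNat)) := by
  have hn0 : 0 < n := by omega
  have hlt : ∀ i i', 1 ≤ i → i < i' → i' ≤ m → a i < a i' := fun i i' h h' h'' =>
    hmono ⟨h, by omega⟩ ⟨by omega, h''⟩ h'
  have hle : ∀ i i', 1 ≤ i → i ≤ i' → i' ≤ m → a i ≤ a i' := fun i i' h h' h'' =>
    hmono.monotoneOn ⟨h, by omega⟩ ⟨by omega, h''⟩ h'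
  have hlo : a (j - 1) < a j ∧ a m - n ≤ a (j - 1) ∧ (j = 1 ∨ a 1 ≤ a (j - 1)) := by
    rcases hj1.eq_or_lt with rfl | h
    · have := hle 1 m le_rfl (by omega) le_rfl
      rw [Nat.sub_self, h0]
      omega
    · have := hlt (j - 1) j (by omega) (by omega) hjm
      have := hle 1 (j - 1) le_rfl (by omega) (by omega)
      omega
  have hhi : a j < a (j + 1) ∧ a (j + 1) ≤ a 1 + n ∧ (j = m ∨ a (j + 1) ≤ a m) := by
    rcases hjm.eq_or_lt with rfl | h
    · have := hle 1 j le_rfl (by omega) le_rfl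
      rw [htop]
      omega
    · have := hlt j (j + 1) (by omega) (by omega) (by omega)
      have := hle (j + 1) m (by omega) (by omega) le_rfl
      omega
  set lo := a (j - 1) with hlo_def
  set hi := a (j + 1) with hhi_def
  set s : ℕ → ℕ := fun i => (a i % (n : ℤ)).toNat with hs
  have hlohi : lo < hi := by omega
  have hlen : hi - lo ≤ n := by
    rcases hhi.2.2 with h | h <;> omega
  have hsn : ∀ i, s i < n := fun i => by
    have := Int.emod_lt_of_pos (a i) (b := n) (by omega)
    simp only [hs]
    omega
  have hpos : ∀ i, arcPos n lo (s i) = (a i - lo) % n := fun i => arcPos_toNat hn0 lo (a i)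
  obtain ⟨i₀, hi₀, hi₀j, hpos₀⟩ : ∃ i ∈ Finset.Icc 1 m, i ≠ j ∧ arcPos n lo (s i) = 0 := by
    rcases hj1.eq_or_lt with h | h
    · refine ⟨m, Finset.mem_Icc.2 ⟨by omega, le_rfl⟩, by omega, ?_⟩
      rw [hpos, hlo_def, ← h, Nat.sub_self, h0, sub_sub_cancel, Int.emod_self]
    · refine ⟨j - 1, Finset.mem_Icc.2 ⟨by omega, by omega⟩, by omega, ?_⟩
      rw [hpos, hlo_def, sub_self, Int.zero_emod]
  obtain ⟨i₁, hi₁, hi₁j, hpos₁⟩ : ∃ i ∈ Finset.Icc 1 m, i ≠ j ∧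
      arcPos n lo (s i) = (hi - lo) % n := by
    rcases hjm.eq_or_lt with h | h
    · refine ⟨1, Finset.mem_Icc.2 ⟨le_rfl, by omega⟩, by omega, ?_⟩
      rw [hpos, hhi_def, h, htop, add_sub_right_comm, Int.add_emod_right]
    · exact ⟨j + 1, Finset.mem_Icc.2 ⟨by omega, by omega⟩, by omega, hpos _⟩
  have houtside : ∀ i ∈ Finset.Icc 1 m, i ≠ j →
      arcPos n lo (s i) = 0 ∨ hi - lo ≤ arcPos n lo (s i) := by
    intro i hi' hij
    rw [Finset.mem_Icc] at hi'
    rw [hpos]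
    rcases lt_or_gt_of_ne hij with h | h
    · have h1 := hle i (j - 1) hi'.1 (by omega) (by omega)
      have h2 := hle 1 i le_rfl hi'.1 hi'.2
      have h3 := hle (j - 1) m (by omega) (by omega) le_rfl
      rcases h1.eq_or_lt with h1 | h1
      · left
        rw [h1, ← hlo_def, sub_self, Int.zero_emod]
      · right
        rw [← Int.add_emod_right, Int.emod_eq_of_lt (by omega) (by omega)]
        omega
    · have h1 := hle (j + 1) i (by omega) (by omega) hi'.2
      have h2 := hle i m hi'.1 hi'.2 le_rfl
      rcases (show a i - lo ≤ n by omega).eq_or_lt with h3 | h3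
      · left
        rw [h3, Int.emod_self]
      · right
        rw [Int.emod_eq_of_lt (by omega) h3]
        omega
  have hperm : ∀ i ∈ Finset.Icc 1 m, i ≠ j →
      ∃ i' ∈ Finset.Icc 1 m, i' ≠ j ∧ reflectArc n lo hi (s i) = s i' := by
    intro i hi' hij
    have hrefl := arcPos_reflectArc hlen (hsn i)
    have hinj : ∀ i', arcPos n lo (reflectArc n lo hi (s i)) = arcPos n lo (s i') →
        reflectArc n lo hi (s i) = s i' := fun i' h =>
      arcPos_injOn (reflectArc_lt lo hi (hsn i)) (hsn i') h
    rcases hlen.eq_or_lt with hl | hl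
    · refine ⟨i, hi', hij, hinj i ?_⟩
      have := houtside i hi' hij
      have := arcPos_bounds lo (hsn i)
      rw [hrefl]
      split_ifs <;> omega
    · rw [Int.emod_eq_of_lt (by omega) hl] at hpos₁
      rcases houtside i hi' hij with h | h
      · refine ⟨i₁, hi₁, hi₁j, hinj i₁ ?_⟩
        rw [hrefl, if_pos (by omega)]
        omega
      · rcases h.eq_or_lt with h | h
        · refine ⟨i₀, hi₀, hi₀j, hinj i₀ ?_⟩
          rw [hrefl, if_pos (by omega)]
          omega
        · exact ⟨i, hi', hij, hinj i (by rw [hrefl, if_neg (by omega)])⟩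
  have hreflj : reflectArc n lo hi (s j) = ((hi + lo - a j) % (n : ℤ)).toNat := by
    have hlt' : ((hi + lo - a j) % (n : ℤ)).toNat < n := by
      have := Int.emod_lt_of_pos (hi + lo - a j) (b := n) (by omega)
      omega
    refine arcPos_injOn (lo := lo) (reflectArc_lt lo hi (hsn j)) hlt' ?_
    rw [arcPos_reflectArc hlen (hsn j), hpos, arcPos_toNat hn0,
      Int.emod_eq_of_lt (a := a j - lo) (by omega) (by omega), if_pos (by omega),
      Int.emod_eq_of_lt (by omega) (by omega)]
    omega
  have hends : HasEnds n lo hi ((Finset.Icc 1 m).image s) :=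
    ⟨⟨_, Finset.mem_image_of_mem s hi₀, hpos₀⟩, fun hl =>
      ⟨_, Finset.mem_image_of_mem s hi₁, by rw [hpos₁, Int.emod_eq_of_lt (by omega) hl]⟩⟩
  have hsub : (Finset.Icc 1 m).image s ⊆ Finset.range n :=
    Finset.image_subset_iff.2 fun i _ => Finset.mem_range.2 (hsn i)
  rw [countA_reflectArc hlen hsub hends]
  congr 1
  have hjmem : j ∈ Finset.Icc 1 m := Finset.mem_Icc.2 ⟨hj1, hjm⟩
  ext x
  simp only [Finset.image_image, Finset.mem_image, Function.comp_apply]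
  constructor
  · rintro ⟨i, hi', rfl⟩
    by_cases hij : i = j
    · refine ⟨j, hjmem, ?_⟩
      rw [Function.update_self, hij, hreflj]
    · obtain ⟨i', hi'', hij', h⟩ := hperm i hi' hij
      refine ⟨i', hi'', ?_⟩
      rw [Function.update_of_ne hij', h]
  · rintro ⟨i, hi', rfl⟩
    by_cases hij : i = j
    · refine ⟨j, hjmem, ?_⟩
      rw [hij, Function.update_self, hreflj]
    · obtain ⟨i', hi'', hij', h⟩ := hperm i hi' hij
      refine ⟨i', hi'', ?_⟩
      rw [Function.update_of_ne hij, ← h, reflectArc_involutive hlen]
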